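/- Let G be a group, A ⊆ G, let 𝓑 be a nonempty family of subsets of G, and let N ≥ 1 be a natural number. Let 𝒟′ := {g₁B ∩ … ∩ gₘB : B ∈ 𝓑, g₁, …, gₘ ∈ G}. Assume 𝒟 is a G-lattice of subsets of G (for the left-multiplication action of G on itself) containing 𝒟′, containing A, and containing B′A for every B′ ∈ 𝒟′, and m is a mean on 𝒟 with m(A) > 0 and m(B) > 0 for every B ∈ 𝓑. Then there exist l ≥ 1, λ ∈ ℝ, B ∈ 𝓑 and g₁, …, gₙ ∈ G such that B′ := B ∩ g₁B ∩ … ∩ gₙB satisfies L_l(B′) and m(B′A) < λ, and moreover: whenever E ∈ 𝓑 and h₁, …, h_m ∈ G are such that E′ := E ∩ h₁E ∩ … ∩ h_mE satisfies L_l(E′) and m(E′A) < λ, the set S := {g ∈ G : L_{l−1}(gE′ ∩ E′)} is generic, symmetric (1 ∈ S and S⁻¹ = S), and satisfies Sᴺ ⊆ E′A(E′A)⁻¹ ⊆ EA(EA)⁻¹, where Sᴺ denotes the set of all products of N elements of S. -/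

import Mathlib

open Pointwise

/-- A subset `D` of a group `G` is generic if finitely many left translates of `D` cover `G`. -/
def IsGeneric {G : Type*} [Group G] (D : Set G) : Prop :=
  ∃ F : Finset G, ∀ g : G, ∃ h ∈ F, h⁻¹ * g ∈ D

/-- A `G`-lattice of subsets of a `G`-set `X`. -/
def IsGLattice (G : Type*) {X : Type*} [Group G] [MulAction G X] (D : Set (Set X)) : Prop :=
  ∅ ∈ D ∧ Set.univ ∈ D ∧ (∀ (g : G), ∀ Y ∈ D, g • Y ∈ D) ∧
    (∀ Y ∈ D, ∀ Z ∈ D, Y ∩ Z ∈ D) ∧ (∀ Y ∈ D, ∀ Z ∈ D, Y ∪ Z ∈ D)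

/-- A mean on a `G`-lattice. -/
def IsMean (G : Type*) {X : Type*} [Group G] [MulAction G X] (D : Set (Set X))
    (m : Set X → ℝ) : Prop :=
  (∀ Y ∈ D, 0 ≤ m Y) ∧ (∀ Y ∈ D, ∀ Z ∈ D, Y ⊆ Z → m Y ≤ m Z) ∧
    (∀ (g : G), ∀ Y ∈ D, m (g • Y) = m Y) ∧ m ∅ = 0 ∧
    (∀ Y ∈ D, ∀ Z ∈ D, m (Y ∪ Z) = m Y + m Z - m (Y ∩ Z))

/-- The generic-largeness predicates `L_k`. -/
def LargeGen (G : Type*) {X : Type*} [Group G] [MulAction G X] : ℕ → Set X → Prop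
  | 0, Y => Y.Nonempty
  | k + 1, Y => IsGeneric {g : G | LargeGen G k (g • Y ∩ Y)}

/-- The family `𝒟′ = {g₁B ∩ … ∩ gₘB : B ∈ ℬ, g₁, …, gₘ ∈ G}`. -/
def InFamIntTrans {G : Type*} [Group G] (ℬ : Set (Set G)) (B' : Set G) : Prop :=
  ∃ B ∈ ℬ, ∃ k : ℕ, ∃ g : Fin (k + 1) → G, B' = ⋂ i, g i • B

theorem IsGeneric.mono {G : Type*} [Group G] {S T : Set G} (hS : IsGeneric S) (h : S ⊆ T) :
    IsGeneric T := by
  obtain ⟨F, hF⟩ := hS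
  refine ⟨F, fun g => ?_⟩
  obtain ⟨x, hx, hxS⟩ := hF g
  exact ⟨x, hx, h hxS⟩

theorem IsGeneric.conj {G : Type*} [Group G] {S : Set G} (hS : IsGeneric S) (a : G) :
    IsGeneric {g : G | a⁻¹ * g * a ∈ S} := by
  classical
  obtain ⟨F, hF⟩ := hS
  refine ⟨F.image fun x => a * x * a⁻¹, fun g => ?_⟩
  obtain ⟨x, hx, hxS⟩ := hF (a⁻¹ * g * a)
  refine ⟨_, Finset.mem_image_of_mem _ hx, ?_⟩
  rw [Set.mem_ofPred_eq]
  convert hxS using 1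
  group

section LargeGen

variable {G X : Type*} [Group G] [MulAction G X]

theorem LargeGen.smul {k : ℕ} {Y : Set X} (hY : LargeGen G k Y) (a : G) :
    LargeGen G k (a • Y) := by
  induction k generalizing Y a with
  | zero => exact Set.Nonempty.smul_set hY
  | succ k ih =>
    refine IsGeneric.mono (IsGeneric.conj hY a) fun g hg => ?_
    have h := ih hg a
    rw [Set.smul_set_inter, smul_smul] at h
    change LargeGen G k (g • a • Y ∩ a • Y)
    rwa [smul_smul, show g * a = a * (a⁻¹ * g * a) by group]

theorem LargeGen.of_succ {k : ℕ} {Y : Set X} (hY : LargeGen G (k + 1) Y) : LargeGen G k Y := by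
  induction k generalizing Y with
  | zero =>
    obtain ⟨F, hF⟩ := hY
    obtain ⟨x, -, hx⟩ := hF 1
    exact Set.Nonempty.mono Set.inter_subset_right hx
  | succ k ih => exact IsGeneric.mono hY fun g hg => ih hg

theorem LargeGen.inv_smul_inter {k : ℕ} {Y : Set X} {g : G} (h : LargeGen G k (g • Y ∩ Y)) :
    LargeGen G k (g⁻¹ • Y ∩ Y) := by
  have := h.smul g⁻¹
  rwa [Set.smul_set_inter, inv_smul_smul, Set.inter_comm] at this

variable {D : Set (Set X)} {m : Set X → ℝ}

/-- The translates which meet a set of positive mean in positive mean form a generic set. -/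
theorem IsMean.isGeneric_pos (hD : IsGLattice G D) (hm : IsMean G D m) {Y : Set X} (hY : Y ∈ D)
    (hpos : 0 < m Y) : IsGeneric {g : G | 0 < m (g • Y ∩ Y)} := by
  classical
  obtain ⟨-, huniv, hsmul, hinter, hunion⟩ := hD
  obtain ⟨hnn, hmono, hinv, -, hmod⟩ := hm
  by_contra hgen
  have key : ∀ n : ℕ, ∃ F : Finset G, ∃ U ∈ D, n * m Y ≤ m U ∧
      ∀ g : G, (∀ h ∈ F, m ((h⁻¹ * g) • Y ∩ Y) ≤ 0) → m (U ∩ g • Y) ≤ 0 := by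
    intro n
    induction n with
    | zero =>
      refine ⟨{1}, Y, hY, by simpa using hpos.le, fun g hg => ?_⟩
      simpa [Set.inter_comm] using hg 1 (by simp)
    | succ n ih =>
      obtain ⟨F, U, hU, hle, hF⟩ := ih
      obtain ⟨g, hg⟩ : ∃ g : G, ∀ h ∈ F, m ((h⁻¹ * g) • Y ∩ Y) ≤ 0 := by
        by_contra! hcon
        exact hgen ⟨F, hcon⟩
      have hgY := hsmul g Y hY
      refine ⟨insert g F, U ∪ g • Y, hunion _ hU _ hgY, ?_, fun a ha => ?_⟩
      · rw [hmod _ hU _ hgY, hinv _ _ hY]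
        have := hF g hg
        push_cast
        linarith
      · have haY := hsmul a Y hY
        have hUa := hinter _ hU _ haY
        have hga := hinter _ hgY _ haY
        rw [Set.union_inter_distrib_right, hmod _ hUa _ hga]
        have h₁ := hF a fun h hh => ha h (Finset.mem_insert_of_mem hh)
        have h₂ := ha g (Finset.mem_insert_self g F)
        rw [← hinv g _ (hinter _ (hsmul _ _ hY) _ hY), Set.smul_set_inter, smul_smul,
          mul_inv_cancel_left, Set.inter_comm] at h₂
        have h₃ := hnn _ (hinter _ hUa _ hga)
        linarith
  obtain ⟨n, hn⟩ := exists_nat_gt (m Set.univ / m Y)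
  obtain ⟨F, U, hU, hle, -⟩ := key n
  rw [div_lt_iff₀ hpos] at hn
  have := hmono U hU _ huniv (Set.subset_univ U)
  linarith

theorem IsMean.largeGen (hD : IsGLattice G D) (hm : IsMean G D m) {Y : Set X} (hY : Y ∈ D)
    (hpos : 0 < m Y) (k : ℕ) : LargeGen G k Y := by
  induction k generalizing Y with
  | zero =>
    refine Set.nonempty_iff_ne_empty.mpr ?_
    rintro rfl
    exact hpos.ne' hm.2.2.2.1
  | succ k ih =>
    exact (hm.isGeneric_pos hD hY hpos).mono fun g hg =>
      ih (hD.2.2.2.1 _ (hD.2.2.1 g Y hY) _ hY) hg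

/-- The triangle inequality for the defect of the mean of an intersection. -/
theorem IsMean.add_le_inter_add (hD : IsGLattice G D) (hm : IsMean G D m) {U V W : Set X}
    (hU : U ∈ D) (hV : V ∈ D) (hW : W ∈ D) :
    m (U ∩ V) + m (V ∩ W) ≤ m (U ∩ W) + m V := by
  obtain ⟨-, -, -, hinter, hunion⟩ := hD
  obtain ⟨-, hmono, -, -, hmod⟩ := hm
  have hUV := hinter _ hU _ hV
  have hVW := hinter _ hV _ hW
  have h₁ := hmod _ hUV _ hVW
  have h₂ := hmono _ (hunion _ hUV _ hVW) _ hV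
    (Set.union_subset Set.inter_subset_right Set.inter_subset_left)
  have h₃ := hmono _ (hinter _ hUV _ hVW) _ (hinter _ hU _ hW)
    fun x hx => ⟨hx.1.1, hx.2.2⟩
  linarith

theorem IsMean.le_inter_smul_of_mem_pow (hD : IsGLattice G D) (hm : IsMean G D m) {Y : Set X}
    (hY : Y ∈ D) {S : Set G} {c : ℝ} (hS : ∀ g ∈ S, c ≤ m (Y ∩ g • Y)) (n : ℕ) {g : G}
    (hg : g ∈ S ^ n) : m Y - n * (m Y - c) ≤ m (Y ∩ g • Y) := by
  induction n generalizing g with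
  | zero =>
    obtain rfl : g = 1 := by simpa using hg
    simp
  | succ n ih =>
    rw [pow_succ] at hg
    obtain ⟨a, ha, s, hs, rfl⟩ := Set.mem_mul.mp hg
    have hsY := hD.2.2.1 s Y hY
    have h₁ := hm.add_le_inter_add hD hY (hD.2.2.1 a Y hY) (hD.2.2.1 a _ hsY)
    rw [← Set.smul_set_inter, hm.2.2.1 a _ (hD.2.2.2.1 _ hY _ hsY), hm.2.2.1 a _ hY,
      smul_smul] at h₁
    have h₂ := ih ha
    have h₃ := hS s hs
    push_cast
    linarith

end LargeGen

/-- The intersections of a member `B` of `ℬ` with finitely many of its left translates. -/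
def interTranslates {G : Type*} [Group G] (ℬ : Set (Set G)) : Set (Set G) :=
  {Y | ∃ B ∈ ℬ, ∃ n : ℕ, ∃ g : Fin n → G, Y = B ∩ ⋂ i, g i • B}

section interTranslates

variable {G : Type*} [Group G] {ℬ : Set (Set G)} {Y : Set G}

theorem mem_interTranslates_of_mem (hY : Y ∈ ℬ) : Y ∈ interTranslates ℬ :=
  ⟨Y, hY, 0, Fin.elim0, by simp⟩

theorem InFamIntTrans.of_mem_interTranslates (hY : Y ∈ interTranslates ℬ) :
    InFamIntTrans ℬ Y := by
  obtain ⟨B, hB, n, g, rfl⟩ := hY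
  refine ⟨B, hB, n, Fin.cons 1 g, ?_⟩
  ext x
  simp [Fin.forall_fin_succ]

theorem smul_inter_mem_interTranslates (hY : Y ∈ interTranslates ℬ) (a : G) :
    a • Y ∩ Y ∈ interTranslates ℬ := by
  obtain ⟨B, hB, n, g, rfl⟩ := hY
  refine ⟨B, hB, n + (n + 1), Fin.append g (Fin.cons a fun i => a * g i), ?_⟩
  ext x
  simp only [Set.smul_set_inter, Set.smul_set_iInter, Set.mem_inter_iff, Set.mem_iInter,
    Fin.forall_fin_add, Fin.append_left, Fin.append_right, Fin.forall_fin_succ, Fin.cons_zero,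
    Fin.cons_succ, mul_smul]
  tauto

end interTranslates

theorem exists_succ_lt_add_of_bddAbove {u : ℕ → ℝ} (hu : BddAbove (Set.range u)) {c : ℝ}
    (hc : 0 < c) : ∃ n, u (n + 1) < u n + c := by
  by_contra! h
  obtain ⟨b, hb⟩ := hu
  have key : ∀ n : ℕ, u 0 + n * c ≤ u n := by
    intro n
    induction n with
    | zero => simp
    | succ n ih =>
      have := h n
      push_cast
      linarith
  obtain ⟨n, hn⟩ := exists_nat_gt ((b - u 0) / c)
  rw [div_lt_iff₀ hc] at hn
  have h₁ := hb ⟨n, rfl⟩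
  have h₂ := key n
  linarith

/-- Corollary 2.11 (semantic form): the uniform choice of `l`, `λ` in the
Massicot–Wagner argument, for a family `ℬ` of subsets of `G`. -/
theorem massicot_wagner_uniform {G : Type*} [Group G]
    (A : Set G) (ℬ : Set (Set G)) (hℬ : ℬ.Nonempty) (N : ℕ) (hN : 1 ≤ N)
    (D : Set (Set G)) (m : Set G → ℝ)
    (hD : IsGLattice G D) (hm : IsMean G D m)
    (hD' : ∀ B' : Set G, InFamIntTrans ℬ B' → B' ∈ D)
    (hA : A ∈ D)
    (hB'A : ∀ B' : Set G, InFamIntTrans ℬ B' → B' * A ∈ D)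
    (hApos : 0 < m A) (hBpos : ∀ B ∈ ℬ, 0 < m B) :
    ∃ l : ℕ, 1 ≤ l ∧ ∃ lam : ℝ, ∃ B ∈ ℬ, ∃ n : ℕ, ∃ g : Fin n → G,
      ∃ B' : Set G, B' = B ∩ ⋂ i, g i • B ∧
        LargeGen G l B' ∧ m (B' * A) < lam ∧
        ∀ E ∈ ℬ, ∀ k : ℕ, ∀ h : Fin k → G, ∀ E' : Set G, E' = E ∩ ⋂ i, h i • E →
          LargeGen G l E' → m (E' * A) < lam →
          ∃ S : Set G, S = {g' : G | LargeGen G (l - 1) (g' • E' ∩ E')} ∧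
            IsGeneric S ∧ (1 : G) ∈ S ∧ S⁻¹ = S ∧
            S ^ N ⊆ (E' * A) * (E' * A)⁻¹ ∧
            (E' * A) * (E' * A)⁻¹ ⊆ (E * A) * (E * A)⁻¹ := by
  have hFD : ∀ Y ∈ interTranslates ℬ, Y * A ∈ D := fun Y hY =>
    hB'A Y (.of_mem_interTranslates hY)
  have hle : ∀ Y ∈ interTranslates ℬ, ∀ k, LargeGen G k Y → m A ≤ m (Y * A) := by
    intro Y hY k hk
    obtain ⟨y, hy⟩ : Y.Nonempty := by
      induction k with
      | zero => exact hk
      | succ k ih => exact ih hk.of_succ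
    rw [← hm.2.2.1 y A hA]
    exact hm.2.1 _ (hD.2.2.1 y A hA) _ (hFD Y hY) (Set.smul_set_subset_mul hy)
  let V : ℕ → Set ℝ := fun k => {r | ∃ Y ∈ interTranslates ℬ, LargeGen G k Y ∧ m (Y * A) = r}
  have hVle : ∀ k, ∀ r ∈ V k, m A ≤ r := by
    rintro k _ ⟨Y, hY, hk, rfl⟩
    exact hle Y hY k hk
  have hVbdd : ∀ k, BddBelow (V k) := fun k => ⟨m A, hVle k⟩
  obtain ⟨B, hB⟩ := hℬ
  have hBF := mem_interTranslates_of_mem hB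
  have hBV : ∀ k, m (B * A) ∈ V k := fun k =>
    ⟨B, hBF, hm.largeGen hD (hD' B (.of_mem_interTranslates hBF)) (hBpos B hB) k, rfl⟩
  have hN' : (0 : ℝ) < N := by exact_mod_cast hN
  obtain ⟨l, hl⟩ := exists_succ_lt_add_of_bddAbove (u := fun k => sInf (V k))
    ⟨m (B * A), by rintro _ ⟨k, rfl⟩; exact csInf_le (hVbdd k) (hBV k)⟩ (div_pos hApos hN')
  obtain ⟨_, ⟨Y, ⟨B₁, hB₁, n, g, hYg⟩, hYl, rfl⟩, hYlt⟩ := exists_lt_of_csInf_lt ⟨_, hBV (l + 1)⟩ hl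
  refine ⟨l + 1, l.succ_pos, _, B₁, hB₁, n, g, Y, hYg, hYl, hYlt, ?_⟩
  intro E hE k h E' hE' hlarge hlt
  have hE'F : E' ∈ interTranslates ℬ := ⟨E, hE, k, h, hE'⟩
  have hE'D := hFD E' hE'F
  refine ⟨_, rfl, hlarge, ?_, ?_, ?_, ?_⟩
  · simpa using hlarge.of_succ
  · ext g'
    exact ⟨fun hg => by simpa using LargeGen.inv_smul_inter hg, LargeGen.inv_smul_inter⟩
  · intro s hs
    have hS : ∀ g' ∈ {g' : G | LargeGen G (l + 1 - 1) (g' • E' ∩ E')},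
        sInf (V l) ≤ m (E' * A ∩ g' • (E' * A)) := by
      intro g' hg'
      have hF := smul_inter_mem_interTranslates hE'F g'
      refine (csInf_le (hVbdd l) ⟨_, hF, hg', rfl⟩).trans ?_
      refine hm.2.1 _ (hFD _ hF) _ (hD.2.2.2.1 _ hE'D _ (hD.2.2.1 g' _ hE'D)) ?_
      rw [← smul_mul_assoc]
      exact Set.subset_inter (Set.mul_subset_mul_right Set.inter_subset_right)
        (Set.mul_subset_mul_right Set.inter_subset_left)
    have hmem := hm.le_inter_smul_of_mem_pow hD hE'D hS N hs
    have hgap : N * (m (E' * A) - sInf (V l)) < m A := by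
      rw [← lt_div_iff₀' hN']
      linarith
    have hpos : 0 < m (E' * A ∩ s • (E' * A)) := by
      linarith [hle E' hE'F _ hlarge]
    obtain ⟨x, hx, y, hy, rfl⟩ := hm.largeGen hD
      (hD.2.2.2.1 _ hE'D _ (hD.2.2.1 s _ hE'D)) hpos 0
    exact ⟨_, hx, y⁻¹, Set.inv_mem_inv.mpr hy, by simp⟩
  · have hsub : E' * A ⊆ E * A := Set.mul_subset_mul_right (hE' ▸ Set.inter_subset_left)
    exact Set.mul_subset_mul hsub (Set.inv_subset_inv.mpr hsub)
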